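/- arXiv:1502.05813 — 2 statements merged into one kernel-verified Lean document; each statement's English description precedes it below -/
import Mathlib

section
/- Let n ≥ 5 and consider the Lie multiplications n₅,₁⊕𝔞ₙ₋₅, n₅,₂⊕𝔞ₙ₋₅, r₂⊕𝔞ₙ₋₂, gₙ,₁(α) (for α ∈ ℂ, α ≠ 0, α ≠ 1), and gₙ,₂ on ℂⁿ. Then none of these multiplications is a degeneration of another: for any two members μ, ν of this list lying in distinct orbits, ν does not lie in closure(Orb(μ)). -/
noncomputable section

abbrev V (n : ℕ) : Type := Fin n → ℂ

abbrev Bil (n : ℕ) : Type := V n →ₗ[ℂ] V n →ₗ[ℂ] V n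

instance BilTop (n : ℕ) : TopologicalSpace (Bil n) :=
  TopologicalSpace.induced (fun μ : Bil n => fun x y : V n => μ x y) inferInstance

/-- The change-of-basis action of a linear automorphism on multiplications. -/
def act {n : ℕ} (g : V n ≃ₗ[ℂ] V n) (μ : Bil n) : Bil n :=
  LinearMap.mk₂ ℂ (fun x y => g (μ (g.symm x) (g.symm y)))
    (fun x x' y => by simp)
    (fun c x y => by simp)
    (fun x y y' => by simp)
    (fun c x y => by simp)

/-- The orbit of a multiplication under the change-of-basis action. -/
def orb {n : ℕ} (μ : Bil n) : Set (Bil n) :=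
  Set.range fun g : V n ≃ₗ[ℂ] V n => act g μ

/-- Two multiplications are isomorphic iff they lie in the same orbit. -/
def Isom {n : ℕ} (μ ν : Bil n) : Prop := ∃ g : V n ≃ₗ[ℂ] V n, act g μ = ν

def levelOne {n : ℕ} (lam : Bil n) : Prop :=
  lam ≠ 0 ∧ closure (orb lam) ⊆ orb lam ∪ {0}

def levelTwo {n : ℕ} (lam : Bil n) : Prop :=
  (∀ μ ∈ closure (orb lam) \ orb lam, closure (orb μ) ⊆ orb μ ∪ {0}) ∧
  ∃ μ ∈ closure (orb lam) \ orb lam, μ ≠ 0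

/-- `E n k` is the standard basis vector `e_{k+1}` of `ℂⁿ` (0-indexed `k`). -/
def E (n k : ℕ) : V n := fun m => if (m : ℕ) = k then 1 else 0

/-- The bilinear multiplication determined by a table of products of basis vectors. -/
def ofTable {n : ℕ} (c : Fin n → Fin n → V n) : Bil n :=
  LinearMap.mk₂ ℂ (fun x y => ∑ i : Fin n, ∑ j : Fin n, (x i * y j) • c i j)
    (fun x x' y => by
      simp [add_mul, add_smul, Finset.sum_add_distrib])
    (fun a x y => by
      simp [Finset.smul_sum, smul_smul, mul_assoc])
    (fun x y y' => by
      simp [mul_add, add_smul, Finset.sum_add_distrib])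
    (fun a x y => by
      simp [Finset.smul_sum, smul_smul, mul_assoc, mul_left_comm])

def JordanMul {n : ℕ} (lam : Bil n) : Prop :=
  (∀ x y : V n, lam x y = lam y x) ∧
  ∀ x y : V n, lam (lam x x) (lam y x) = lam (lam (lam x x) y) x

def LieMul {n : ℕ} (lam : Bil n) : Prop :=
  (∀ x : V n, lam x x = 0) ∧
  ∀ x y z : V n, lam x (lam y z) + lam y (lam z x) + lam z (lam x y) = 0

def AssocMul {n : ℕ} (lam : Bil n) : Prop :=
  ∀ x y z : V n, lam (lam x y) z = lam x (lam y z)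
/-- `n₅,₁ ⊕ 𝔞_{n-5}`: `[e₁,e₃] = e₅`, `[e₂,e₄] = e₅`. -/
def n51 (n : ℕ) : Bil n :=
  ofTable fun i j =>
    if i.val = 0 ∧ j.val = 2 then E n 4
    else if i.val = 2 ∧ j.val = 0 then -E n 4
    else if i.val = 1 ∧ j.val = 3 then E n 4
    else if i.val = 3 ∧ j.val = 1 then -E n 4
    else 0

/-- `n₅,₂ ⊕ 𝔞_{n-5}`: `[e₁,e₂] = e₄`, `[e₁,e₃] = e₅`. -/
def n52 (n : ℕ) : Bil n :=
  ofTable fun i j =>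
    if i.val = 0 ∧ j.val = 1 then E n 3
    else if i.val = 1 ∧ j.val = 0 then -E n 3
    else if i.val = 0 ∧ j.val = 2 then E n 4
    else if i.val = 2 ∧ j.val = 0 then -E n 4
    else 0

/-- `r₂ ⊕ 𝔞_{n-2}`: `[e₁,e₂] = e₂`. -/
def r2 (n : ℕ) : Bil n :=
  ofTable fun i j =>
    if i.val = 0 ∧ j.val = 1 then E n 1
    else if i.val = 1 ∧ j.val = 0 then -E n 1
    else 0

/-- `g_{n,1}(α)`: `[e₁,e₂] = α e₂`, `[e₁,eᵢ] = eᵢ` for `3 ≤ i ≤ n`. -/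
def g1 (n : ℕ) (α : ℂ) : Bil n :=
  ofTable fun i j =>
    if i.val = 0 ∧ j.val = 1 then α • E n 1
    else if i.val = 1 ∧ j.val = 0 then -(α • E n 1)
    else if i.val = 0 ∧ 2 ≤ j.val then E n j.val
    else if j.val = 0 ∧ 2 ≤ i.val then -E n i.val
    else 0

/-- `g_{n,2}`: `[e₁,e₂] = e₂ + e₃`, `[e₁,eᵢ] = eᵢ` for `3 ≤ i ≤ n`. -/
def g2 (n : ℕ) : Bil n :=
  ofTable fun i j =>
    if i.val = 0 ∧ j.val = 1 then E n 1 + E n 2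
    else if i.val = 1 ∧ j.val = 0 then -(E n 1 + E n 2)
    else if i.val = 0 ∧ 2 ≤ j.val then E n j.val
    else if j.val = 0 ∧ 2 ≤ i.val then -E n i.val
    else 0

def co (n k : ℕ) : V n →ₗ[ℂ] ℂ := if h : k < n then LinearMap.proj ⟨k, h⟩ else 0

lemma co_E {n k : ℕ} (h : k < n) (j : ℕ) : co n k (E n j) = if k = j then 1 else 0 := by
  simp [co, h, E]

def wedge {n : ℕ} (f p : V n →ₗ[ℂ] ℂ) (v : V n) : Bil n :=
  LinearMap.mk₂ ℂ (fun x y => (f x * p y - f y * p x) • v)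
    (fun x x' y => by simp only [map_add]; module)
    (fun c x y => by simp only [map_smul, smul_eq_mul]; module)
    (fun x y y' => by simp only [map_add]; module)
    (fun c x y => by simp only [map_smul, smul_eq_mul]; module)

def base {n : ℕ} (f : V n →ₗ[ℂ] ℂ) : Bil n :=
  LinearMap.mk₂ ℂ (fun x y => f x • y - f y • x)
    (fun x x' y => by simp only [map_add]; module)
    (fun c x y => by simp only [map_smul, smul_eq_mul]; module)
    (fun x y y' => by simp only [map_add]; module)
    (fun c x y => by simp only [map_smul, smul_eq_mul]; module)

@[simp] lemma wedge_apply {n : ℕ} (f p : V n →ₗ[ℂ] ℂ) (v x y : V n) :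
    wedge f p v x y = (f x * p y - f y * p x) • v := rfl

@[simp] lemma base_apply {n : ℕ} (f : V n →ₗ[ℂ] ℂ) (x y : V n) :
    base f x y = f x • y - f y • x := rfl

@[simp] lemma act_apply {n : ℕ} (g : V n ≃ₗ[ℂ] V n) (μ : Bil n) (x y : V n) :
    act g μ x y = g (μ (g.symm x) (g.symm y)) := rfl

lemma sum_E {n : ℕ} (x : V n) : x = ∑ i : Fin n, x i • E n i.val := by
  ext m
  simp [E, Fin.val_inj]

lemma ofTable_eq {n : ℕ} (c : Fin n → Fin n → V n) (F : Bil n)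
    (h : ∀ i j : Fin n, F (E n i.val) (E n j.val) = c i j) : ofTable c = F := by
  refine LinearMap.ext fun x => LinearMap.ext fun y => ?_
  conv_rhs => rw [sum_E x, sum_E y]
  simp only [map_sum, LinearMap.sum_apply, map_smul, LinearMap.smul_apply, h, Finset.smul_sum, smul_smul]
  change ∑ i : Fin n, ∑ j : Fin n, (x i * y j) • c i j = _
  first
  | rfl
  | (refine Finset.sum_congr rfl fun i _ => Finset.sum_congr rfl fun j _ => ?_
     rw [mul_comm]; done)
  | (rw [Finset.sum_comm]
     refine Finset.sum_congr rfl fun i _ => Finset.sum_congr rfl fun j _ => ?_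
     first
     | rfl
     | rw [mul_comm])

lemma n51_eq {n : ℕ} (hn : 5 ≤ n) :
    n51 n = wedge (co n 0) (co n 2) (E n 4) + wedge (co n 1) (co n 3) (E n 4) := by
  refine ofTable_eq _ _ fun i j => ?_
  simp only [LinearMap.add_apply, wedge_apply, co_E (show 0 < n by omega), co_E (show 1 < n by omega),
    co_E (show 2 < n by omega), co_E (show 3 < n by omega)]
  generalize i.val = a
  generalize j.val = b
  rcases a with _ | _ | _ | _ | a <;> rcases b with _ | _ | _ | _ | b <;> simp

lemma n52_eq {n : ℕ} (hn : 5 ≤ n) :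
    n52 n = wedge (co n 0) (co n 1) (E n 3) + wedge (co n 0) (co n 2) (E n 4) := by
  refine ofTable_eq _ _ fun i j => ?_
  simp only [LinearMap.add_apply, wedge_apply, co_E (show 0 < n by omega), co_E (show 1 < n by omega),
    co_E (show 2 < n by omega), co_E (show 3 < n by omega)]
  split_ifs <;> first | omega | (simp)

lemma r2_eq {n : ℕ} (hn : 5 ≤ n) :
    r2 n = wedge (co n 0) (co n 1) (E n 1) := by
  refine ofTable_eq _ _ fun i j => ?_
  simp only [wedge_apply, co_E (show 0 < n by omega), co_E (show 1 < n by omega)]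
  split_ifs <;> first | omega | (simp)

lemma g1_eq {n : ℕ} (hn : 5 ≤ n) (α : ℂ) :
    g1 n α = base (co n 0) + wedge (co n 0) (co n 1) ((α - 1) • E n 1) := by
  refine ofTable_eq _ _ fun i j => ?_
  simp only [LinearMap.add_apply, base_apply, wedge_apply, co_E (show 0 < n by omega),
    co_E (show 1 < n by omega)]
  split_ifs <;> first
    | omega
    | (simp; done)
    | (have h1 : j.val = 1 := by omega
       simp only [h1]; module)
    | (have h1 : i.val = 1 := by omega
       simp only [h1]; module)
    | (have h1 : i.val = j.val := by omega
       simp only [h1]; module)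

lemma g2_eq {n : ℕ} (hn : 5 ≤ n) :
    g2 n = base (co n 0) + wedge (co n 0) (co n 1) (E n 2) := by
  refine ofTable_eq _ _ fun i j => ?_
  simp only [LinearMap.add_apply, base_apply, wedge_apply, co_E (show 0 < n by omega),
    co_E (show 1 < n by omega)]
  split_ifs <;> first
    | omega
    | (simp; done)
    | (have h1 : j.val = 1 := by omega
       simp only [h1]; module)
    | (have h1 : i.val = 1 := by omega
       simp only [h1]; module)
    | (have h1 : i.val = j.val := by omega
       simp only [h1]; module)

lemma cont_eval {n : ℕ} (x y : V n) : Continuous (fun μ : Bil n => μ x y) := by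
  have h : Continuous (fun μ : Bil n => fun x y : V n => μ x y) := continuous_induced_dom
  exact (continuous_apply y).comp ((continuous_apply x).comp h)

lemma of_closure {n : ℕ} {μ ν : Bil n} (P : Bil n → Prop) (hc : IsClosed {lam | P lam})
    (h : ∀ g, P (act g μ)) (hν : ν ∈ closure (orb μ)) : P ν := by
  have : closure (orb μ) ⊆ {lam | P lam} := by
    refine closure_minimal ?_ hc
    rintro _ ⟨g, rfl⟩
    exact h g
  exact this hν

/-- Pfaffian condition. -/
def Pf {n : ℕ} (μ : Bil n) : Prop := ∀ (φ : V n →ₗ[ℂ] ℂ) (x y z w : V n),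
  φ (μ x y) * φ (μ z w) - φ (μ x z) * φ (μ y w) + φ (μ x w) * φ (μ y z) = 0

lemma Pf_closed {n : ℕ} : IsClosed {μ : Bil n | Pf μ} := by
  simp only [Pf, Set.ofPred_forall]
  refine isClosed_iInter fun φ => isClosed_iInter fun x => isClosed_iInter fun y =>
    isClosed_iInter fun z => isClosed_iInter fun w => ?_
  have h : ∀ x y : V n, Continuous (fun μ : Bil n => φ (μ x y)) := fun x y =>
    (LinearMap.continuous_of_finiteDimensional φ).comp (cont_eval x y)
  exact isClosed_eq ((((h _ _).mul (h _ _)).sub ((h _ _).mul (h _ _))).add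
    ((h _ _).mul (h _ _))) continuous_const

lemma Pf_act {n : ℕ} {μ : Bil n} (h : Pf μ) (g : V n ≃ₗ[ℂ] V n) : Pf (act g μ) := by
  intro φ x y z w
  exact h (φ ∘ₗ g.toLinearMap) (g.symm x) (g.symm y) (g.symm z) (g.symm w)

/-- Derived algebra of dimension at most one. -/
def D1 {n : ℕ} (μ : Bil n) : Prop := ∀ (x y z w : V n),
  ¬ LinearIndependent ℂ ![μ x y, μ z w]

lemma pair_closed {n : ℕ} {a b : Bil n → V n} (ha : Continuous a) (hb : Continuous b) :
    IsClosed {μ : Bil n | ¬ LinearIndependent ℂ ![a μ, b μ]} := by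
  have h : IsOpen {f : Fin 2 → V n | LinearIndependent ℂ f} := isOpen_setOfPred_linearIndependent
  refine (h.preimage (f := fun μ : Bil n => ![a μ, b μ]) ?_).isClosed_compl
  refine continuous_pi fun i => ?_
  fin_cases i
  · exact ha
  · exact hb

lemma D1_closed {n : ℕ} : IsClosed {μ : Bil n | D1 μ} := by
  simp only [D1, Set.ofPred_forall]
  exact isClosed_iInter fun x => isClosed_iInter fun y =>
    isClosed_iInter fun z => isClosed_iInter fun w => pair_closed (cont_eval _ _) (cont_eval _ _)

lemma dep_pair {n : ℕ} (s t : ℂ) (v : V n) : ¬ LinearIndependent ℂ ![s • v, t • v] := by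
  intro h
  rw [LinearIndependent.pair_iff] at h
  have h1 := h t (-s) (by module)
  have hs : s = 0 := by simpa using h1.2
  have h2 := h 1 0 (by simp [hs])
  simpa using h2.1

lemma D1_act {n : ℕ} {μ : Bil n} (v : V n) (ω : V n → V n → ℂ) (h : ∀ x y, μ x y = ω x y • v)
    (g : V n ≃ₗ[ℂ] V n) : D1 (act g μ) := by
  intro x y z w
  simp only [act_apply, h, map_smul]
  exact dep_pair _ _ _

/-- Nilpotency condition. -/
def Nil {n : ℕ} (μ : Bil n) : Prop := ∀ x y : V n, μ x (μ x y) = 0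

lemma Nil_closed {n : ℕ} : IsClosed {μ : Bil n | Nil μ} := by
  simp only [Nil, Set.ofPred_forall]
  refine isClosed_iInter fun x => isClosed_iInter fun y => isClosed_eq ?_ continuous_const
  have h : (fun μ : Bil n => μ x (μ x y)) =
      fun μ : Bil n => ∑ i : Fin n, (μ x y) i • μ x (E n i.val) := by
    funext μ
    conv_lhs => rw [sum_E (μ x y)]
    simp
  rw [h]
  exact continuous_finsetSum _ fun i _ =>
    ((continuous_apply i).comp (cont_eval x y)).smul (cont_eval _ _)

lemma Nil_act {n : ℕ} {μ : Bil n} (h : Nil μ) (g : V n ≃ₗ[ℂ] V n) : Nil (act g μ) := by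
  intro x y
  simp [h (g.symm x) (g.symm y)]

/-- Shape of the algebras `g`. -/
def Shape {n : ℕ} (c : ℂ) (μ : Bil n) : Prop := ∃ (f p : V n →ₗ[ℂ] ℂ) (v : V n),
  f v = 0 ∧ p v = c ∧ μ = base f + wedge f p v

lemma Shape_act {n : ℕ} {c : ℂ} {μ : Bil n} (h : Shape c μ) (g : V n ≃ₗ[ℂ] V n) :
    Shape c (act g μ) := by
  obtain ⟨f, p, v, h1, h2, rfl⟩ := h
  refine ⟨f ∘ₗ g.symm.toLinearMap, p ∘ₗ g.symm.toLinearMap, g v, by simpa, by simpa, ?_⟩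
  refine LinearMap.ext fun x => LinearMap.ext fun y => ?_
  simp

def tr {n : ℕ} (μ : Bil n) (x : V n) : ℂ := LinearMap.trace ℂ (V n) (μ x)

lemma tr_cont {n : ℕ} (x : V n) : Continuous (fun μ : Bil n => tr μ x) := by
  have h : (fun μ : Bil n => tr μ x) =
      fun μ : Bil n => ∑ i : Fin n, (μ x (Pi.single i 1)) i := by
    funext μ
    rw [tr, LinearMap.trace_eq_matrix_trace ℂ (Pi.basisFun ℂ (Fin n)), Matrix.trace]
    simp [LinearMap.toMatrix_apply]
  rw [h]
  exact continuous_finsetSum _ fun i _ => (continuous_apply i).comp (cont_eval _ _)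

lemma tr_wedge {n : ℕ} (f p : V n →ₗ[ℂ] ℂ) (v x : V n) :
    tr (wedge f p v) x = f x * p v - f v * p x := by
  have : wedge f p v x = f x • p.smulRight v - p x • f.smulRight v := by
    refine LinearMap.ext fun y => ?_
    simp only [wedge_apply, LinearMap.sub_apply, LinearMap.smul_apply, LinearMap.smulRight_apply]
    module
  rw [tr, this]
  simp [LinearMap.trace_smulRight, mul_comm]

lemma tr_base {n : ℕ} (f : V n →ₗ[ℂ] ℂ) (x : V n) :
    tr (base f) x = f x * (n - 1) := by
  have : base f x = f x • LinearMap.id - f.smulRight x := by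
    refine LinearMap.ext fun y => ?_
    simp only [base_apply, LinearMap.sub_apply, LinearMap.smul_apply, LinearMap.smulRight_apply,
      LinearMap.id_apply]
  rw [tr, this]
  simp [LinearMap.trace_smulRight]
  ring

lemma tr_add {n : ℕ} (μ ν : Bil n) (x : V n) : tr (μ + ν) x = tr μ x + tr ν x := by
  simp [tr]

/-- The main closed condition. -/
def Tc {n : ℕ} (c : ℂ) (μ : Bil n) : Prop := ∀ x y z w : V n,
  ¬ LinearIndependent ℂ ![(n - 1 + c) • μ x y - tr μ x • y + tr μ y • x,
    (n - 1 + c) • μ z w - tr μ z • w + tr μ w • z]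

lemma Tc_closed {n : ℕ} (c : ℂ) : IsClosed {μ : Bil n | Tc c μ} := by
  simp only [Tc, Set.ofPred_forall]
  have h : ∀ x y : V n, Continuous
      (fun μ : Bil n => ((n : ℂ) - 1 + c) • μ x y - tr μ x • y + tr μ y • x) := fun x y => by
    have h1 : Continuous (fun μ : Bil n => ((n : ℂ) - 1 + c) • μ x y) :=
      (continuous_const_smul _).comp (cont_eval x y)
    have h2 : Continuous (fun μ : Bil n => tr μ x • y) :=
      (continuous_id.smul continuous_const).comp (tr_cont x)
    have h3 : Continuous (fun μ : Bil n => tr μ y • x) :=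
      (continuous_id.smul continuous_const).comp (tr_cont y)
    exact (h1.sub h2).add h3
  exact isClosed_iInter fun x => isClosed_iInter fun y =>
    isClosed_iInter fun z => isClosed_iInter fun w => pair_closed (h _ _) (h _ _)

lemma tr_shape {n : ℕ} {f p : V n →ₗ[ℂ] ℂ} {v : V n} (h1 : f v = 0) (x : V n) :
    tr (base f + wedge f p v) x = (n - 1 + p v) * f x := by
  rw [tr_add, tr_base, tr_wedge, h1]
  ring

lemma Tc_of_shape {n : ℕ} {c : ℂ} {μ : Bil n} (h : Shape c μ) : Tc c μ := by
  obtain ⟨f, p, v, h1, rfl, rfl⟩ := h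
  intro x y z w
  have key : ∀ x y : V n, ((n : ℂ) - 1 + p v) • (base f + wedge f p v) x y
      - tr (base f + wedge f p v) x • y + tr (base f + wedge f p v) y • x =
      ((n - 1 + p v) * (f x * p y - f y * p x)) • v := by
    intro x y
    simp only [tr_shape h1, LinearMap.add_apply, base_apply, wedge_apply]
    module
  rw [key, key]
  exact dep_pair _ _ _

lemma Pf_of_shape {n : ℕ} {c : ℂ} {μ : Bil n} (h : Shape c μ) : Pf μ := by
  obtain ⟨f, p, v, h1, h2, rfl⟩ := h
  intro φ x y z w
  simp only [LinearMap.add_apply, base_apply, wedge_apply, map_add, map_sub, map_smul, smul_eq_mul]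
  ring

/-- Condition excluding `n52`. -/
def F5 {n : ℕ} (μ : Bil n) : Prop := ∀ x y z : V n,
  ¬ LinearIndependent ℂ ![x, y, z, μ x y, μ x z]

lemma F5_closed {n : ℕ} : IsClosed {μ : Bil n | F5 μ} := by
  simp only [F5, Set.ofPred_forall]
  refine isClosed_iInter fun x => isClosed_iInter fun y => isClosed_iInter fun z => ?_
  have h : IsOpen {f : Fin 5 → V n | LinearIndependent ℂ f} := isOpen_setOfPred_linearIndependent
  refine (h.preimage (f := fun μ : Bil n => ![x, y, z, μ x y, μ x z]) ?_).isClosed_compl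
  refine continuous_pi fun i => ?_
  fin_cases i
  · exact continuous_const
  · exact continuous_const
  · exact continuous_const
  · exact cont_eval _ _
  · exact cont_eval _ _

lemma F5_of_shape {n : ℕ} {c : ℂ} {μ : Bil n} (h : Shape c μ) : F5 μ := by
  obtain ⟨f, p, v, h1, h2, rfl⟩ := h
  intro x y z hl
  rw [Fintype.linearIndependent_iff] at hl
  set s := f x * p y - f y * p x with hs
  set t := f x * p z - f z * p x with ht
  have e1 : (base f + wedge f p v) x y = f x • y - f y • x + s • v := rfl
  have e2 : (base f + wedge f p v) x z = f x • z - f z • x + t • v := rfl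
  rw [e1, e2] at hl
  have a := hl ![t * f y - s * f z, - t * f x, s * f x, t, -s] (by
    simp only [Fin.sum_univ_five]
    simp
    module)
  have ht0 : t = 0 := a 3
  have hs0 : s = 0 := by have := a 4; simpa using this
  have b := hl ![f y, - f x, 0, 1, 0] (by
    simp only [Fin.sum_univ_five]
    simp [hs0]
    module)
  have : (1 : ℂ) = 0 := b 3
  exact one_ne_zero this

lemma indep_E {n m : ℕ} (k : Fin m → ℕ) (hk : Function.Injective k) (h : ∀ i, k i < n) :
    LinearIndependent ℂ (fun i => E n (k i)) := by
  have h0 : LinearIndependent ℂ (fun i : Fin m => Pi.basisFun ℂ (Fin n) ⟨k i, h i⟩) :=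
    (Pi.basisFun ℂ (Fin n)).linearIndependent.comp _ (fun i j hij => hk (by simpa using hij))
  convert h0 using 2 with i
  ext j
  simp [E, Pi.single_apply, Fin.ext_iff]

lemma indep_smul {n a b : ℕ} (ha : a < n) (hb : b < n) (hab : a ≠ b) {s : ℂ} (hs : s ≠ 0) :
    LinearIndependent ℂ ![s • E n a, s • E n b] := by
  rw [LinearIndependent.pair_iff]
  intro u w h
  have h1 := congrFun h ⟨a, ha⟩
  have h2 := congrFun h ⟨b, hb⟩
  simp [E, hab, hab.symm, hs] at h1 h2
  exact ⟨h1, h2⟩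

lemma E_ne {n a : ℕ} (ha : a < n) : E n a ≠ 0 := by
  intro h
  have h1 := congrFun h ⟨a, ha⟩
  simp [E] at h1

lemma g1_shape {n : ℕ} (hn : 5 ≤ n) (α : ℂ) : Shape (α - 1) (g1 n α) :=
  ⟨_, _, _, by simp [co_E (show 0 < n by omega)], by simp [co_E (show 1 < n by omega)], g1_eq hn α⟩

lemma g2_shape {n : ℕ} (hn : 5 ≤ n) : Shape 0 (g2 n) :=
  ⟨_, _, _, by simp [co_E (show 0 < n by omega)], by simp [co_E (show 1 < n by omega)], g2_eq hn⟩

/-- special form for targets -/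
def GForm {n : ℕ} (c : ℂ) (μ : Bil n) : Prop := ∃ v : V n,
  co n 0 v = 0 ∧ co n 1 v = c ∧ μ = base (co n 0) + wedge (co n 0) (co n 1) v

lemma g1_form {n : ℕ} (hn : 5 ≤ n) (α : ℂ) : GForm (α - 1) (g1 n α) :=
  ⟨_, by simp [co_E (show 0 < n by omega)], by simp [co_E (show 1 < n by omega)], g1_eq hn α⟩

lemma g2_form {n : ℕ} (hn : 5 ≤ n) : GForm 0 (g2 n) :=
  ⟨_, by simp [co_E (show 0 < n by omega)], by simp [co_E (show 1 < n by omega)], g2_eq hn⟩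

lemma GForm.mul {n : ℕ} (hn : 5 ≤ n) {c : ℂ} {μ : Bil n} (h : GForm c μ) {k : ℕ} (hk : 2 ≤ k) :
    μ (E n 0) (E n k) = E n k := by
  obtain ⟨v, h1, h2, rfl⟩ := h
  have h3 : (0 : ℕ) ≠ k := by omega
  have h4 : (1 : ℕ) ≠ k := by omega
  simp [co_E (show 0 < n by omega), co_E (show 1 < n by omega), h3, h4]

lemma GForm.not_D1 {n : ℕ} (hn : 5 ≤ n) {c : ℂ} {μ : Bil n} (h : GForm c μ) : ¬ D1 μ := by
  intro hd
  apply hd (E n 0) (E n 3) (E n 0) (E n 4)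
  rw [h.mul hn (by norm_num), h.mul hn (by norm_num)]
  simpa using indep_smul (n := n) (a := 3) (b := 4) (by omega) (by omega) (by norm_num)
    (one_ne_zero (α := ℂ))

lemma GForm.not_Nil {n : ℕ} (hn : 5 ≤ n) {c : ℂ} {μ : Bil n} (h : GForm c μ) : ¬ Nil μ := by
  intro hd
  have := hd (E n 0) (E n 3)
  rw [h.mul hn (by norm_num), h.mul hn (by norm_num)] at this
  exact E_ne (by omega) this

lemma GForm.not_Tc {n : ℕ} (hn : 5 ≤ n) {c d : ℂ} {μ : Bil n} (h : GForm c μ) (hcd : d ≠ c) :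
    ¬ Tc d μ := by
  intro hd
  apply hd (E n 0) (E n 3) (E n 0) (E n 4)
  rw [h.mul hn (by norm_num), h.mul hn (by norm_num)]
  obtain ⟨v, h1, rfl, rfl⟩ := h
  simp only [tr_shape h1, co_E (show 0 < n by omega)]
  have := indep_smul (n := n) (a := 3) (b := 4) (by omega) (by omega) (by norm_num)
    (sub_ne_zero.mpr hcd)
  convert this using 2
  · simp; module
  · congr 1; simp; module

lemma r2_not_Tc {n : ℕ} (hn : 5 ≤ n) (d : ℂ) : ¬ Tc d (r2 n) := by
  intro hd
  apply hd (E n 0) (E n 3) (E n 0) (E n 4)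
  rw [r2_eq hn]
  simp only [tr_wedge, wedge_apply, co_E (show 0 < n by omega), co_E (show 1 < n by omega)]
  have := indep_smul (n := n) (a := 3) (b := 4) (by omega) (by omega) (by norm_num)
    (neg_ne_zero.mpr (one_ne_zero (α := ℂ)))
  simpa using this

lemma r2_not_Nil {n : ℕ} (hn : 5 ≤ n) : ¬ Nil (r2 n) := by
  intro hd
  have := hd (E n 0) (E n 1)
  rw [r2_eq hn] at this
  simp [co_E (show 0 < n by omega), co_E (show 1 < n by omega)] at this
  exact E_ne (by omega) this

lemma n51_not_Pf {n : ℕ} (hn : 5 ≤ n) : ¬ Pf (n51 n) := by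
  intro hd
  have := hd (co n 4) (E n 0) (E n 2) (E n 1) (E n 3)
  rw [n51_eq hn] at this
  simp [co_E (show 0 < n by omega), co_E (show 1 < n by omega), co_E (show 2 < n by omega),
    co_E (show 3 < n by omega), co_E (show 4 < n by omega)] at this

lemma n52_mul1 {n : ℕ} (hn : 5 ≤ n) : n52 n (E n 0) (E n 1) = E n 3 := by
  rw [n52_eq hn]
  simp [co_E (show 0 < n by omega), co_E (show 1 < n by omega), co_E (show 2 < n by omega)]

lemma n52_mul2 {n : ℕ} (hn : 5 ≤ n) : n52 n (E n 0) (E n 2) = E n 4 := by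
  rw [n52_eq hn]
  simp [co_E (show 0 < n by omega), co_E (show 1 < n by omega), co_E (show 2 < n by omega)]

lemma n52_not_D1 {n : ℕ} (hn : 5 ≤ n) : ¬ D1 (n52 n) := by
  intro hd
  apply hd (E n 0) (E n 1) (E n 0) (E n 2)
  rw [n52_mul1 hn, n52_mul2 hn]
  simpa using indep_smul (n := n) (a := 3) (b := 4) (by omega) (by omega) (by norm_num)
    (one_ne_zero (α := ℂ))

lemma n52_not_F5 {n : ℕ} (hn : 5 ≤ n) : ¬ F5 (n52 n) := by
  intro hd
  apply hd (E n 0) (E n 1) (E n 2)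
  rw [n52_mul1 hn, n52_mul2 hn]
  have := indep_E (n := n) (fun i : Fin 5 => i.val) Fin.val_injective (fun i => by omega)
  convert this using 1
  ext1 i
  fin_cases i <;> rfl

lemma n51_Nil {n : ℕ} (hn : 5 ≤ n) : Nil (n51 n) := by
  intro x y
  rw [n51_eq hn]
  simp [co_E (show 0 < n by omega), co_E (show 1 < n by omega), co_E (show 2 < n by omega),
    co_E (show 3 < n by omega)]

lemma n52_Nil {n : ℕ} (hn : 5 ≤ n) : Nil (n52 n) := by
  intro x y
  rw [n52_eq hn]
  simp [co_E (show 0 < n by omega), co_E (show 1 < n by omega), co_E (show 2 < n by omega)]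

lemma n52_Pf {n : ℕ} (hn : 5 ≤ n) : Pf (n52 n) := by
  intro φ x y z w
  rw [n52_eq hn]
  simp only [LinearMap.add_apply, wedge_apply, map_add, map_smul, smul_eq_mul]
  ring

lemma r2_Pf {n : ℕ} (hn : 5 ≤ n) : Pf (r2 n) := by
  intro φ x y z w
  rw [r2_eq hn]
  simp only [wedge_apply, map_smul, smul_eq_mul]
  ring

lemma n51_D1 {n : ℕ} (hn : 5 ≤ n) (g : V n ≃ₗ[ℂ] V n) : D1 (act g (n51 n)) := by
  rw [n51_eq hn]
  refine D1_act (E n 4) (fun x y => (co n 0 x * co n 2 y - co n 0 y * co n 2 x) +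
    (co n 1 x * co n 3 y - co n 1 y * co n 3 x)) (fun x y => ?_) g
  simp only [LinearMap.add_apply, wedge_apply, ← add_smul]

lemma r2_D1 {n : ℕ} (hn : 5 ≤ n) (g : V n ≃ₗ[ℂ] V n) : D1 (act g (r2 n)) := by
  rw [r2_eq hn]
  exact D1_act (E n 1) _ (fun x y => rfl) g

lemma shape_not_n51 {n : ℕ} (hn : 5 ≤ n) {c : ℂ} {μ : Bil n} (h : Shape c μ) :
    n51 n ∉ closure (orb μ) := fun hc =>
  n51_not_Pf hn (of_closure Pf Pf_closed (Pf_act (Pf_of_shape h)) hc)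

lemma shape_not_n52 {n : ℕ} (hn : 5 ≤ n) {c : ℂ} {μ : Bil n} (h : Shape c μ) :
    n52 n ∉ closure (orb μ) := fun hc =>
  n52_not_F5 hn (of_closure F5 F5_closed (fun g => F5_of_shape (Shape_act h g)) hc)

lemma shape_not_r2 {n : ℕ} (hn : 5 ≤ n) {c : ℂ} {μ : Bil n} (h : Shape c μ) :
    r2 n ∉ closure (orb μ) := fun hc =>
  r2_not_Tc hn c (of_closure (Tc c) (Tc_closed c) (fun g => Tc_of_shape (Shape_act h g)) hc)

lemma shape_not_g {n : ℕ} (hn : 5 ≤ n) {c d : ℂ} {μ ν : Bil n} (h : Shape c μ) (hν : GForm d ν)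
    (hcd : c ≠ d) : ν ∉ closure (orb μ) := fun hc =>
  hν.not_Tc hn hcd
    (of_closure (Tc c) (Tc_closed c) (fun g => Tc_of_shape (Shape_act h g)) hc)

lemma self_orb {n : ℕ} (μ : Bil n) : μ ∈ orb μ :=
  ⟨LinearEquiv.refl ℂ _, LinearMap.ext fun x => LinearMap.ext fun y => rfl⟩

/-- none of the five level-two Lie multiplications is a degeneration of
another one lying in a different orbit. -/
theorem lie_level_two_no_degenerations (n : ℕ) (hn : 5 ≤ n) :
    ∀ μ ∈ ({lam | lam = n51 n ∨ lam = n52 n ∨ lam = r2 n ∨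
        (∃ α : ℂ, α ≠ 0 ∧ α ≠ 1 ∧ lam = g1 n α) ∨ lam = g2 n} : Set (Bil n)),
      ∀ ν ∈ ({lam | lam = n51 n ∨ lam = n52 n ∨ lam = r2 n ∨
          (∃ α : ℂ, α ≠ 0 ∧ α ≠ 1 ∧ lam = g1 n α) ∨ lam = g2 n} : Set (Bil n)),
        ν ∉ orb μ → ν ∉ closure (orb μ) := by
  rintro μ (rfl | rfl | rfl | ⟨α, hα0, hα1, rfl⟩ | rfl) ν
    (rfl | rfl | rfl | ⟨β, hβ0, hβ1, rfl⟩ | rfl) ho hc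
  · exact ho (self_orb _)
  · exact n52_not_D1 hn (of_closure D1 D1_closed (n51_D1 hn) hc)
  · exact r2_not_Nil hn (of_closure Nil Nil_closed (Nil_act (n51_Nil hn)) hc)
  · exact (g1_form hn β).not_D1 hn (of_closure D1 D1_closed (n51_D1 hn) hc)
  · exact (g2_form hn).not_D1 hn (of_closure D1 D1_closed (n51_D1 hn) hc)
  · exact n51_not_Pf hn (of_closure Pf Pf_closed (Pf_act (n52_Pf hn)) hc)
  · exact ho (self_orb _)
  · exact r2_not_Nil hn (of_closure Nil Nil_closed (Nil_act (n52_Nil hn)) hc)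
  · exact (g1_form hn β).not_Nil hn (of_closure Nil Nil_closed (Nil_act (n52_Nil hn)) hc)
  · exact (g2_form hn).not_Nil hn (of_closure Nil Nil_closed (Nil_act (n52_Nil hn)) hc)
  · exact n51_not_Pf hn (of_closure Pf Pf_closed (Pf_act (r2_Pf hn)) hc)
  · exact n52_not_D1 hn (of_closure D1 D1_closed (r2_D1 hn) hc)
  · exact ho (self_orb _)
  · exact (g1_form hn β).not_D1 hn (of_closure D1 D1_closed (r2_D1 hn) hc)
  · exact (g2_form hn).not_D1 hn (of_closure D1 D1_closed (r2_D1 hn) hc)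
  · exact shape_not_n51 hn (g1_shape hn α) hc
  · exact shape_not_n52 hn (g1_shape hn α) hc
  · exact shape_not_r2 hn (g1_shape hn α) hc
  · by_cases hab : α = β
    · subst hab
      exact ho (self_orb _)
    · exact shape_not_g hn (g1_shape hn α) (g1_form hn β)
        (fun h => hab (sub_left_injective h)) hc
  · exact shape_not_g hn (g1_shape hn α) (g2_form hn) (sub_ne_zero.mpr hα1) hc
  · exact shape_not_n51 hn (g2_shape hn) hc
  · exact shape_not_n52 hn (g2_shape hn) hc
  · exact shape_not_r2 hn (g2_shape hn) hc
  · exact shape_not_g hn (g2_shape hn) (g1_form hn β) (sub_ne_zero.mpr hβ1).symm hc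
  · exact ho (self_orb _)
end
end

section
/- Let n ≥ 5 and let λ be a Lie multiplication on ℂⁿ such that λ is nilpotent and the derived subspace span{λ x y : x, y ∈ ℂⁿ} has dimension at least 2. Then the Lie multiplication n₅,₂⊕𝔞ₙ₋₅ lies in closure(Orb(λ)). -/
noncomputable section

/-- The lower central series of a Lie multiplication: `C¹ = ℂⁿ` (index 0 here),
`C^(k+1) = span {λ x y : x ∈ ℂⁿ, y ∈ C^k}`. -/
def lcs {n : ℕ} (lam : Bil n) : ℕ → Submodule ℂ (V n)
  | 0 => ⊤
  | (k+1) => Submodule.span ℂ {z : V n | ∃ x : V n, ∃ y ∈ lcs lam k, lam x y = z}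

open Filter Topology

def wt (i : ℕ) : ℕ := if i = 0 then 1 else if i = 1 then 2 else if i = 2 then 2 else 3

lemma exists_basis_ext {m : ℕ} (v : Fin 5 → V (5+m)) (hv : LinearIndependent ℂ v) :
    ∃ b : Module.Basis (Fin (5+m)) ℂ (V (5+m)), ∀ i : Fin 5, b (Fin.castAdd m i) = v i := by
  classical
  let B := Module.Basis.sumExtend hv
  have : Fintype (Fin 5 ⊕ Module.Basis.sumExtendIndex hv) := FiniteDimensional.fintypeBasisIndex B
  have : Fintype (Module.Basis.sumExtendIndex hv) := Fintype.ofInjective (Sum.inr : _ → Fin 5 ⊕ Module.Basis.sumExtendIndex hv) Sum.inr_injective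
  have hc : Fintype.card (Module.Basis.sumExtendIndex hv) = m := by
    have h1 := Module.finrank_eq_card_basis B
    rw [Module.finrank_fin_fun] at h1
    have h2 : Fintype.card (Fin 5 ⊕ Module.Basis.sumExtendIndex hv) = 5 + Fintype.card (Module.Basis.sumExtendIndex hv) := by
      rw [← Nat.card_eq_fintype_card, ← Nat.card_eq_fintype_card, Nat.card_sum]; simp
    omega
  let e := Fintype.equivFinOfCardEq hc
  refine ⟨B.reindex (((Equiv.refl (Fin 5)).sumCongr e).trans finSumFinEquiv), fun i => ?_⟩
  have : (((Equiv.refl (Fin 5)).sumCongr e).trans finSumFinEquiv).symm (Fin.castAdd m i) = Sum.inl i := by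
    rw [Equiv.symm_apply_eq]; simp
  rw [Module.Basis.reindex_apply, this]
  simp [B, Module.Basis.sumExtend]
  rfl

def gs {n : ℕ} (b : Module.Basis (Fin n) ℂ (V n)) (s : ℂ) (hs : s ≠ 0) : V n ≃ₗ[ℂ] V n :=
  b.equivFun.trans
    (LinearEquiv.piCongrRight fun k => LinearEquiv.smulOfNeZero ℂ ℂ (s ^ wt k) (pow_ne_zero _ hs))

lemma gs_apply {n : ℕ} (b : Module.Basis (Fin n) ℂ (V n)) (s : ℂ) (hs : s ≠ 0) (v : V n) (k : Fin n) :
    gs b s hs v k = s ^ wt k * b.repr v k := by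
  simp [gs]

lemma gs_symm {n : ℕ} (b : Module.Basis (Fin n) ℂ (V n)) (s : ℂ) (hs : s ≠ 0) (i : Fin n) :
    (gs b s hs).symm (Pi.single i 1) = (s⁻¹ ^ wt i) • b i := by
  rw [LinearEquiv.symm_apply_eq]
  ext k
  rw [gs_apply]
  by_cases h : k = i
  · subst h
    simp [hs]
  · simp [h, Finsupp.single_apply, Ne.symm h]

lemma bil_expand {n : ℕ} (mu : Bil n) (x y : V n) :
    mu x y = ∑ i, ∑ j, (x i * y j) • mu (Pi.single i 1) (Pi.single j 1) := by
  conv_lhs => rw [pi_eq_sum_univ' x, pi_eq_sum_univ' y]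
  simp only [map_sum, LinearMap.sum_apply, map_smul, LinearMap.smul_apply, Finset.smul_sum, smul_smul]
  rw [Finset.sum_comm]
  refine Finset.sum_congr rfl fun i _ => Finset.sum_congr rfl fun j _ => ?_
  congr 1
  ring

lemma ofTable_single {n : ℕ} (c : Fin n → Fin n → V n) (i j : Fin n) :
    ofTable c (Pi.single i 1) (Pi.single j 1) = c i j := by
  simp only [ofTable, LinearMap.mk₂_apply]
  rw [Finset.sum_eq_single i, Finset.sum_eq_single j]
  · simp
  · intro b _ hb; simp [hb]
  · simp
  · intro b _ hb; simp [hb]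
  · simp

lemma degen {m : ℕ} (lam : Bil (5+m)) (hL : ∀ x, lam x x = 0) (x y z : V (5+m))
    (h : LinearIndependent ℂ ![x, y, z, lam x y, lam x z]) : n52 (5+m) ∈ closure (orb lam) := by
  obtain ⟨b, hb⟩ := exists_basis_ext _ h
  have anti : ∀ u v, lam u v = - lam v u := by
    intro u v
    have := hL (u+v)
    simp [hL] at this
    exact eq_neg_of_add_eq_zero_left this
  have hb0 : b (Fin.castAdd m 0) = x := hb 0
  have hb1 : b (Fin.castAdd m 1) = y := hb 1
  have hb2 : b (Fin.castAdd m 2) = z := hb 2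
  have hb3 : b (Fin.castAdd m 3) = lam x y := hb 3
  have hb4 : b (Fin.castAdd m 4) = lam x z := hb 4
  have hs : ∀ r : ℕ, ((r:ℂ) + 1) ≠ 0 := fun r => Nat.cast_add_one_ne_zero r
  refine mem_closure_of_tendsto (f := fun r : ℕ => act (gs b ((r:ℂ)+1) (hs r)) lam) (b := atTop) ?_
    (Eventually.of_forall fun r => ⟨_, rfl⟩)
  have hind : IsInducing (fun μ : Bil (5+m) => fun x y : V (5+m) => μ x y) := ⟨rfl⟩
  rw [hind.tendsto_nhds_iff, tendsto_pi_nhds]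
  intro p
  rw [tendsto_pi_nhds]
  intro q
  simp only [Function.comp_def]
  rw [bil_expand (n52 (5+m))]
  simp_rw [fun r : ℕ => bil_expand (act (gs b ((r:ℂ)+1) (hs r)) lam) p q]
  refine tendsto_finsetSum _ fun i _ => tendsto_finsetSum _ fun j _ => Tendsto.const_smul ?_ _
  rw [tendsto_pi_nhds]
  intro k
  have hval : ∀ r : ℕ, act (gs b ((r:ℂ)+1) (hs r)) lam (Pi.single i 1) (Pi.single j 1) k
      = (((r:ℂ)+1)⁻¹ ^ (wt i + wt j) * ((r:ℂ)+1) ^ wt k) * b.repr (lam (b i) (b j)) k := by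
    intro r
    simp only [act, LinearMap.mk₂_apply, gs_symm, gs_apply, map_smul, LinearMap.smul_apply,
      Finsupp.smul_apply, smul_eq_mul]
    ring
  simp_rw [hval]
  have hlim : Tendsto (fun r : ℕ => ((r:ℂ)+1)⁻¹) atTop (𝓝 0) := by
    simpa using tendsto_one_div_add_atTop_nhds_zero_nat (𝕜 := ℂ)
  have hpow : wt k < wt i + wt j → Tendsto (fun r : ℕ => (((r:ℂ)+1)⁻¹ ^ (wt i + wt j) * ((r:ℂ)+1) ^ wt k) * b.repr (lam (b i) (b j)) k) atTop (𝓝 0) := by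
    intro hlt
    have : ∀ r : ℕ, ((r:ℂ)+1)⁻¹ ^ (wt i + wt j) * ((r:ℂ)+1) ^ wt k = ((r:ℂ)+1)⁻¹ ^ (wt i + wt j - wt k) := by
      intro r
      obtain ⟨d, hd⟩ := Nat.exists_eq_add_of_lt hlt
      have h1 : wt i + wt j - wt k = d + 1 := by omega
      have h2 : wt i + wt j = (d + 1) + wt k := by omega
      rw [h1, h2, pow_add, mul_assoc, ← mul_pow, inv_mul_cancel₀ (hs r), one_pow, mul_one]
    simp_rw [this]
    have h3 := (hlim.pow (wt i + wt j - wt k)).mul_const (b.repr (lam (b i) (b j)) k)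
    rwa [zero_pow (by omega), zero_mul] at h3
  have hk3 : wt k ≤ 3 := by unfold wt; split_ifs <;> omega
  have key : ∀ (l : Fin (5+m)), (l.val = 3 ∨ l.val = 4) → wt i + wt j = 3 → ∀ c : ℂ, lam (b i) (b j) = c • b l →
      n52 (5+m) (Pi.single i 1) (Pi.single j 1) = c • E (5+m) l → Tendsto (fun r : ℕ => (((r:ℂ)+1)⁻¹ ^ (wt i + wt j) * ((r:ℂ)+1) ^ wt k) * b.repr (lam (b i) (b j)) k) atTop
        (𝓝 (n52 (5+m) (Pi.single i 1) (Pi.single j 1) k)) := by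
    intro l hl hw c h1 h2
    rw [h1, h2]
    by_cases hkl : k = l
    · subst hkl
      have hwk : wt k = 3 := by unfold wt; split_ifs <;> omega
      rw [hw, hwk]
      have : ∀ r : ℕ, ((r:ℂ)+1)⁻¹ ^ 3 * ((r:ℂ)+1) ^ 3 = 1 := by
        intro r
        rw [← mul_pow, inv_mul_cancel₀ (hs r), one_pow]
      simp_rw [this]
      simp [E]
    · have : (k:ℕ) ≠ l := fun h => hkl (Fin.ext h)
      simp [E, this, Finsupp.single_apply, Ne.symm hkl]
  by_cases c00 : i.val = 0 ∧ j.val = 0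
  · have : i = j := Fin.ext (by omega)
    subst this
    simp [hL, n52, ofTable_single, c00]
  by_cases c01 : i.val = 0 ∧ j.val = 1
  · have hi : i = Fin.castAdd m 0 := Fin.ext (by simp [c01])
    have hj : j = Fin.castAdd m 1 := Fin.ext (by simp [c01])
    refine key (Fin.castAdd m 3) (by simp) (by simp [c01, wt]) 1 ?_ ?_
    · rw [hi, hj, hb0, hb1, hb3, one_smul]
    · simp only [n52, ofTable_single, c01.1, c01.2]; simp
  by_cases c10 : i.val = 1 ∧ j.val = 0
  · have hi : i = Fin.castAdd m 1 := Fin.ext (by simp [c10])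
    have hj : j = Fin.castAdd m 0 := Fin.ext (by simp [c10])
    refine key (Fin.castAdd m 3) (by simp) (by simp [c10, wt]) (-1) ?_ ?_
    · rw [hi, hj, hb0, hb1, hb3, anti]; simp
    · simp only [n52, ofTable_single, c10.1, c10.2]; simp
  by_cases c02 : i.val = 0 ∧ j.val = 2
  · have hi : i = Fin.castAdd m 0 := Fin.ext (by simp [c02])
    have hj : j = Fin.castAdd m 2 := Fin.ext (by simp [c02])
    refine key (Fin.castAdd m 4) (by simp) (by simp [c02, wt]) 1 ?_ ?_
    · rw [hi, hj, hb0, hb2, hb4, one_smul]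
    · simp only [n52, ofTable_single, c02.1, c02.2]; simp
  by_cases c20 : i.val = 2 ∧ j.val = 0
  · have hi : i = Fin.castAdd m 2 := Fin.ext (by simp [c20])
    have hj : j = Fin.castAdd m 0 := Fin.ext (by simp [c20])
    refine key (Fin.castAdd m 4) (by simp) (by simp [c20, wt]) (-1) ?_ ?_
    · rw [hi, hj, hb0, hb2, hb4, anti]; simp
    · simp only [n52, ofTable_single, c20.1, c20.2]; simp
  have hz : n52 (5+m) (Pi.single i 1) (Pi.single j 1) = 0 := by
    rw [n52, ofTable_single]
    simp only [c01, c10, c02, c20, if_false]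
  rw [hz]
  apply hpow
  have : 4 ≤ wt i + wt j := by unfold wt; split_ifs <;> omega
  omega

lemma ex_rank2 {n : ℕ} (lam : Bil n) (hL : ∀ x, lam x x = 0)
    (hder : 2 ≤ Module.finrank ℂ
      (Submodule.span ℂ {z : V n | ∃ x y : V n, lam x y = z})) :
    ∃ x y z, LinearIndependent ℂ ![lam x y, lam x z] := by
  have anti : ∀ u v, lam u v = - lam v u := by
    intro u v
    have := hL (u+v)
    simp [hL] at this
    exact eq_neg_of_add_eq_zero_left this
  by_contra! hcon
  have hdep : ∀ x y z, lam x y ≠ 0 → ∃ c : ℂ, lam x z = c • lam x y := by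
    intro x y z h
    have := hcon x y z
    rw [LinearIndependent.pair_iff' h] at this
    push Not at this
    obtain ⟨a, ha⟩ := this
    exact ⟨a, ha.symm⟩
  obtain ⟨x, y, hxy⟩ : ∃ x y, lam x y ≠ 0 := by
    by_contra! h0
    have : {z : V n | ∃ x y : V n, lam x y = z} ⊆ {0} := by
      rintro _ ⟨x, y, rfl⟩; simp [h0]
    have h1 := Submodule.span_mono (R := ℂ) this
    have h2 := Submodule.finrank_mono h1
    rw [Submodule.span_zero_singleton, finrank_bot] at h2
    omega
  obtain ⟨z, w, hzw⟩ : ∃ z w, ∀ c : ℂ, c • lam x y ≠ lam z w := by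
    by_contra! h0
    have : {z : V n | ∃ x y : V n, lam x y = z} ⊆ (Submodule.span ℂ {lam x y} : Set (V n)) := by
      rintro _ ⟨p, q, rfl⟩
      obtain ⟨c, hc⟩ := h0 p q
      exact Submodule.mem_span_singleton.2 ⟨c, hc⟩
    have h1 := Submodule.span_le.2 this
    have h2 := Submodule.finrank_mono h1
    rw [finrank_span_singleton hxy] at h2
    omega
  have hli : LinearIndependent ℂ ![lam x y, lam z w] := (LinearIndependent.pair_iff' hxy).2 hzw
  have hzw0 : lam z w ≠ 0 := fun h => hzw 0 (by simp [h])
  have hyx : lam y x ≠ 0 := by rw [anti]; simpa using hxy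
  have hwz : lam w z ≠ 0 := by rw [anti]; simpa using hzw0
  rw [LinearIndependent.pair_iff] at hli
  have h1 : lam z y = 0 := by
    obtain ⟨c, hc⟩ := hdep z w y hzw0
    obtain ⟨d, hd⟩ := hdep y x z hyx
    rw [anti y z, anti y x] at hd
    have := hli (-d) c (by rw [← hc]; rw [neg_eq_iff_eq_neg] at hd; rw [hd]; simp)
    rw [hc, this.2, zero_smul]
  have h2 : lam x w = 0 := by
    obtain ⟨c, hc⟩ := hdep x y w hxy
    obtain ⟨d, hd⟩ := hdep w z x hwz
    rw [anti w x, anti w z] at hd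
    have := hli c (-d) (by rw [← hc]; rw [neg_eq_iff_eq_neg] at hd; rw [hd]; simp)
    rw [hc, this.1, zero_smul]
  apply hcon (x+z) y w
  rw [LinearIndependent.pair_iff]
  simpa [h1, h2] using hli

lemma nil_iter {n : ℕ} (lam : Bil n) (x y : V n) (k : ℕ) : ((lam x)^k) y ∈ lcs lam k := by
  induction k with
  | zero => simp [lcs]
  | succ k ih =>
    rw [pow_succ']
    exact Submodule.subset_span ⟨x, _, ih, rfl⟩

lemma not_im {n : ℕ} (lam : Bil n) (hL : ∀ x, lam x x = 0) (hnil : ∃ m : ℕ, lcs lam m = ⊥)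
    (x : V n) (hx : x ≠ 0) (w : V n) : lam x w ≠ x := by
  intro h
  have anti : ∀ u v, lam u v = - lam v u := by
    intro u v
    have := hL (u+v)
    simp [hL] at this
    exact eq_neg_of_add_eq_zero_left this
  have : ∀ k, x ∈ lcs lam k := by
    intro k
    induction k with
    | zero => simp [lcs]
    | succ k ih =>
      refine Submodule.subset_span ⟨-w, x, ih, ?_⟩
      rw [map_neg, LinearMap.neg_apply, ← anti, h]
  obtain ⟨m, hm⟩ := hnil
  have h1 := this m
  rw [hm] at h1
  exact hx (by simpa using h1)

/-- vectors `y, Ny, N²y` for a nilpotent `N` with `N²y ≠ 0`. -/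
lemma nil_indep {n : ℕ} (N : V n →ₗ[ℂ] V n) (y : V n) (hN : ∃ m, (N^m) y = 0) (h2 : N (N y) ≠ 0)
    (a b c : ℂ) (h : a • y + b • N y + c • N (N y) = 0) : a = 0 ∧ b = 0 ∧ c = 0 := by
  classical
  obtain ⟨k, hk1, hk2⟩ : ∃ k, (N^(k+2)) y ≠ 0 ∧ (N^(k+3)) y = 0 := by
    have hf := Nat.find_spec hN
    have hm : ∀ j, j < Nat.find hN → (N^j) y ≠ 0 := fun j hj => Nat.find_min hN hj
    have hge : 3 ≤ Nat.find hN := by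
      by_contra hlt
      have : (N^2) y = 0 := by
        have h3 : 2 = (2 - Nat.find hN) + Nat.find hN := by omega
        rw [h3, pow_add, Module.End.mul_apply, hf, map_zero]
      exact h2 (by simpa [pow_two] using this)
    refine ⟨Nat.find hN - 3, hm _ (by omega), ?_⟩
    rw [Nat.sub_add_cancel hge]; exact hf
  have e1 : ∀ j, (N^j) (N y) = (N^(j+1)) y := fun j => by rw [pow_succ]; rfl
  have e2 : ∀ j, (N^j) (N (N y)) = (N^(j+2)) y := fun j => by rw [pow_add, pow_two]; rfl
  have e4 : (N^(k+4)) y = 0 := by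
    rw [show k + 4 = 1 + (k+3) by omega, pow_add, Module.End.mul_apply, hk2, map_zero]
  have ha : a = 0 := by
    have := congrArg (N^(k+2)) h
    simp only [map_add, map_smul, e1, e2, map_zero] at this
    rw [show k+2+1 = k+3 by omega, show k+2+2 = k+4 by omega, hk2, e4] at this
    simpa [hk1] using this
  subst ha
  have hb : b = 0 := by
    have := congrArg (N^(k+1)) h
    simp only [map_add, map_smul, e1, e2, map_zero] at this
    rw [show k+1+1 = k+2 by omega, show k+1+2 = k+3 by omega, hk2] at this
    simpa [hk1] using this
  subst hb
  exact ⟨rfl, rfl, by simpa [h2] using h⟩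

lemma li4 {n : ℕ} (x y z u : V n)
    (h : ∀ a b c d : ℂ, a • x + b • y + c • z + d • u = 0 → a = 0 ∧ b = 0 ∧ c = 0 ∧ d = 0) :
    LinearIndependent ℂ ![x, y, z, u] := by
  rw [Fintype.linearIndependent_iff]
  intro g hg
  simp [Fin.sum_univ_succ] at hg
  obtain ⟨h0, h1, h2, h3⟩ := h _ _ _ _ (by rw [← hg]; module)
  intro i
  fin_cases i <;> assumption

lemma li5 {n : ℕ} (x y z u v : V n)
    (h : ∀ a b c d e : ℂ, a • x + b • y + c • z + d • u + e • v = 0 → a = 0 ∧ b = 0 ∧ c = 0 ∧ d = 0 ∧ e = 0) :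
    LinearIndependent ℂ ![x, y, z, u, v] := by
  rw [Fintype.linearIndependent_iff]
  intro g hg
  simp [Fin.sum_univ_succ] at hg
  obtain ⟨h0, h1, h2, h3, h4⟩ := h _ _ _ _ _ (by rw [← hg]; module)
  intro i
  fin_cases i <;> assumption

lemma ex_five {m : ℕ} (lam : Bil (5+m)) (hL : ∀ x, lam x x = 0)
    (hnil : ∃ k : ℕ, lcs lam k = ⊥)
    (hder : 2 ≤ Module.finrank ℂ
      (Submodule.span ℂ {z : V (5+m) | ∃ x y : V (5+m), lam x y = z})) :
    ∃ x y z, LinearIndependent ℂ ![x, y, z, lam x y, lam x z] := by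
  obtain ⟨x, y, z, hli⟩ := ex_rank2 lam hL hder
  rw [LinearIndependent.pair_iff] at hli
  have hx : x ≠ 0 := by
    rintro rfl
    have := hli 1 1 (by simp)
    simp at this
  have him : ∀ (a : ℂ) w, a • x + lam x w = 0 → a = 0 := by
    intro a w h
    by_contra ha
    apply not_im lam hL hnil x hx (-(a⁻¹ • w))
    rw [map_neg, map_smul, eq_neg_of_add_eq_zero_right h, smul_neg, neg_neg, smul_smul,
      inv_mul_cancel₀ ha, one_smul]
  by_cases hN2 : ∀ y, lam x (lam x y) = 0
  · refine ⟨x, y, z, li5 _ _ _ _ _ ?_⟩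
    intro a b c d e h
    have h1 := congrArg (lam x) h
    simp only [map_add, map_smul, hL, hN2, map_zero, smul_zero, zero_add, add_zero] at h1
    obtain ⟨rfl, rfl⟩ := hli _ _ h1
    simp only [zero_smul, add_zero] at h
    obtain rfl := him a (d • y + e • z) (by rw [← h]; simp only [map_add, map_smul]; module)
    obtain ⟨rfl, rfl⟩ := hli d e (by rw [← h]; module)
    simp
  push Not at hN2
  clear hli y z
  obtain ⟨y, hy⟩ := hN2
  have hNn : ∃ k, ((lam x)^k) (lam x y) = 0 := by
    obtain ⟨k, hk⟩ := hnil
    refine ⟨k, ?_⟩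
    have := nil_iter lam x (lam x y) k
    rw [hk] at this
    simpa using this
  have hNn' : ∃ k, ((lam x)^k) y = 0 := by
    obtain ⟨k, hk⟩ := hNn
    exact ⟨k+1, by rw [pow_succ]; exact hk⟩
  have hI : ∀ a b c d : ℂ, a • x + b • y + c • lam x y + d • lam x (lam x y) = 0 →
      a = 0 ∧ b = 0 ∧ c = 0 ∧ d = 0 := by
    intro a b c d h
    have hb : b = 0 := by
      by_contra hb
      have h1 := congrArg (lam x) h
      simp only [map_add, map_smul, hL, map_zero, smul_zero, zero_add] at h1
      by_cases h3 : lam x (lam x (lam x y)) = 0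
      · have := nil_indep (lam x) y hNn' hy 0 b c (by rw [← h1, h3]; module)
        exact hb this.2.1
      · have := nil_indep (lam x) (lam x y) hNn h3 b c d h1
        exact hb this.1
    subst hb
    have ha := him a (c • y + d • lam x y) (by rw [← h]; simp only [map_add, map_smul]; module)
    subst ha
    have := nil_indep (lam x) y hNn' hy 0 c d (by rw [← h]; module)
    exact ⟨rfl, rfl, this.2⟩
  obtain ⟨a, ha⟩ : ∃ a, a ∉ Submodule.span ℂ (Set.range ![x, y, lam x y, lam x (lam x y)]) := by
    by_contra! hall
    have h1 := finrank_range_le_card (R := ℂ) ![x, y, lam x y, lam x (lam x y)]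
    have h2 : Submodule.span ℂ (Set.range ![x, y, lam x y, lam x (lam x y)]) = ⊤ := by
      rw [eq_top_iff]; intro v _; exact hall v
    rw [Set.finrank, h2, finrank_top, Module.finrank_fin_fun] at h1
    simp at h1
    omega
  have ha' : ∀ p q r s t : ℂ, p • a + (q • x + r • y + s • lam x y + t • lam x (lam x y)) = 0 → p = 0 := by
    intro p q r s t h
    by_contra hp
    apply ha
    have h1 : a = (-p⁻¹) • (q • x + r • y + s • lam x y + t • lam x (lam x y)) := by
      rw [neg_smul, ← smul_neg, ← eq_neg_of_add_eq_zero_left h, smul_smul, inv_mul_cancel₀ hp, one_smul]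
    rw [h1]
    have hm : ∀ i : Fin 4, ![x, y, lam x y, lam x (lam x y)] i ∈ Submodule.span ℂ (Set.range ![x, y, lam x y, lam x (lam x y)]) :=
      fun i => Submodule.subset_span ⟨i, rfl⟩
    exact Submodule.smul_mem _ _ (Submodule.add_mem _ (Submodule.add_mem _ (Submodule.add_mem _
      (Submodule.smul_mem _ _ (hm 0)) (Submodule.smul_mem _ _ (hm 1))) (Submodule.smul_mem _ _ (hm 2)))
      (Submodule.smul_mem _ _ (hm 3)))
  -- x, y, a, Ny independent
  have hJ : ∀ p q r s : ℂ, p • x + q • y + r • a + s • lam x y = 0 → p = 0 ∧ q = 0 ∧ r = 0 ∧ s = 0 := by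
    intro p q r s h
    have hr := ha' r p q s 0 (by rw [← h]; module)
    subst hr
    have := hI p q s 0 (by rw [← h]; module)
    exact ⟨this.1, this.2.1, rfl, this.2.2.1⟩
  by_cases hA : ∃ p q r s : ℂ, lam x a = p • x + q • y + r • a + s • lam x y
  · refine ⟨x, y, a + lam x y, li5 _ _ _ _ _ ?_⟩
    obtain ⟨p, q, r, s, hA⟩ := hA
    intro c1 c2 c3 c4 c5 h
    rw [map_add, hA] at h
    by_cases h5 : c5 = 0
    · subst h5
      obtain ⟨h1, h2, h3, h4⟩ := hJ c1 c2 c3 (c3 + c4) (by rw [← h]; module)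
      subst h3
      exact ⟨h1, h2, rfl, by simpa using h4, rfl⟩
    · exfalso
      have h3 := ha' (c3 + c5 * r) (c1 + c5 * p) (c2 + c5 * q) (c3 + c4 + c5 * s) c5 (by rw [← h]; module)
      have := hI (c1 + c5 * p) (c2 + c5 * q) (c3 + c4 + c5 * s) c5 (by
        rw [← h]
        have : c3 = - (c5 * r) := eq_neg_of_add_eq_zero_left h3
        rw [this]
        module)
      exact h5 this.2.2.2
  · refine ⟨x, y, a, li5 _ _ _ _ _ ?_⟩
    intro c1 c2 c3 c4 c5 h
    by_cases h5 : c5 = 0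
    · subst h5
      obtain ⟨h1, h2, h3, h4⟩ := hJ c1 c2 c3 c4 (by rw [← h]; module)
      exact ⟨h1, h2, h3, h4, rfl⟩
    · exfalso
      apply hA
      refine ⟨-c5⁻¹ * c1, -c5⁻¹ * c2, -c5⁻¹ * c3, -c5⁻¹ * c4, ?_⟩
      have h1 : c5 • lam x a = -(c1 • x + c2 • y + c3 • a + c4 • lam x y) :=
        eq_neg_of_add_eq_zero_right h
      have h2 : lam x a = c5⁻¹ • (c5 • lam x a) := by
        rw [smul_smul, inv_mul_cancel₀ h5, one_smul]
      rw [h2, h1]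
      module

/-- a nilpotent Lie multiplication whose derived subspace has dimension
at least 2 degenerates to `n₅,₂ ⊕ 𝔞_{n-5}`. -/
theorem nilpotent_lie_degenerates_n52 (n : ℕ) (hn : 5 ≤ n) (lam : Bil n)
    (hL : LieMul lam) (hnil : ∃ m : ℕ, lcs lam m = ⊥)
    (hder : 2 ≤ Module.finrank ℂ
      (Submodule.span ℂ {z : V n | ∃ x y : V n, lam x y = z})) :
    n52 n ∈ closure (orb lam) := by
  obtain ⟨m, rfl⟩ := Nat.exists_eq_add_of_le hn
  obtain ⟨x, y, z, h⟩ := ex_five lam hL.1 hnil hder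
  exact degen lam hL.1 x y z h
end
end
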